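/- Let β ∈ (0,1). There exists a constant C_β > 0 such that for every f ∈ C²_β[0,1], every ε ∈ (0,1], every k > 0 and every s ∈ [1, 1+β], |∫_0^ε f(x) exp(ikx) dx| ≤ (2/k) sup_{x∈[0,1]} |f(x)| + C_β ε^{1+β−s} (1/k)^s ‖f‖_{2,β}. -/

import Mathlib

open scoped Real

/-- For `β ∈ (0,1)`: the set of values `|v(x)|` for `x ∈ [0,1]` and
`|x^{j−β} v^{(j)}(x)|` for `j = 1,…,m`, `x ∈ (0,1]`, whose supremum is `‖v‖_{m,β}`. -/
noncomputable def snormSetPos (m : ℕ) (β : ℝ) (f : ℝ → ℂ) : Set ℝ :=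
  {y | (∃ x ∈ Set.Icc (0 : ℝ) 1, y = ‖f x‖) ∨
    (∃ j, 1 ≤ j ∧ j ≤ m ∧ ∃ x ∈ Set.Ioc (0 : ℝ) 1,
      y = x ^ ((j : ℝ) - β) * ‖iteratedDerivWithin j f (Set.Ioc (0 : ℝ) 1) x‖)}

/-- The norm `‖v‖_{m,β}` for `β ∈ (0,1)`. -/
noncomputable def snormPos (m : ℕ) (β : ℝ) (f : ℝ → ℂ) : ℝ := sSup (snormSetPos m β f)

open MeasureTheory Set

lemma norm_cexp_I_mul_ofReal_mul_ofReal (k x : ℝ) :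
    ‖Complex.exp (Complex.I * k * x)‖ = 1 := by
  rw [show Complex.I * k * x = ((k * x : ℝ) : ℂ) * Complex.I by push_cast; ring,
    Complex.norm_exp_ofReal_mul_I]

/-- One integration by parts against `exp (ikx)`. -/
lemma norm_integral_mul_cexp_le_of_hasDerivAt {a b k : ℝ} (hab : a ≤ b) (hk : 0 < k)
    {u v : ℝ → ℂ} (hu : ContinuousOn u (Icc a b))
    (huv : ∀ x ∈ Ioo a b, HasDerivAt u (v x) x) (hv : IntervalIntegrable v volume a b) :
    ‖∫ x in a..b, u x * Complex.exp (Complex.I * k * x)‖ ≤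
      1 / k * (‖u b‖ + ‖u a‖ + ‖∫ x in a..b, v x * Complex.exp (Complex.I * k * x)‖) := by
  have hk' : (k : ℂ) ≠ 0 := by exact_mod_cast hk.ne'
  have hc : Complex.I * k ≠ 0 := mul_ne_zero Complex.I_ne_zero hk'
  have hcont : Continuous fun x : ℝ => Complex.exp (Complex.I * k * x) := by fun_prop
  have hexp (x : ℝ) : HasDerivAt (fun x : ℝ => Complex.exp (Complex.I * k * x) / (Complex.I * k))
      (Complex.exp (Complex.I * k * x)) x := by
    have h := (((Complex.ofRealCLM.hasDerivAt (x := x)).const_mul (Complex.I * k)).cexp).div_const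
      (Complex.I * k)
    refine h.congr_deriv ?_
    simp [mul_div_assoc, div_self hc]
  have key := intervalIntegral.integral_mul_deriv_eq_deriv_mul_of_hasDeriv_right
    (u := u) (u' := v) (v := fun x : ℝ => Complex.exp (Complex.I * k * x) / (Complex.I * k))
    (v' := fun x : ℝ => Complex.exp (Complex.I * k * x)) (a := a) (b := b)
    (by rwa [uIcc_of_le hab]) (hcont.div_const _).continuousOn
    (by
      rw [min_eq_left hab, max_eq_right hab]
      exact fun x hx => (huv x hx).hasDerivWithinAt)
    (fun x _ => (hexp x).hasDerivWithinAt) hv (hcont.intervalIntegrable _ _)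
  have hint : ∫ x in a..b, v x * (Complex.exp (Complex.I * k * x) / (Complex.I * k)) =
      (∫ x in a..b, v x * Complex.exp (Complex.I * k * x)) / (Complex.I * k) := by
    rw [← intervalIntegral.integral_div]
    simp only [mul_div_assoc]
  have hnorm : ‖Complex.I * (k : ℂ)‖ = k := by simp [abs_of_pos hk]
  rw [key, hint]
  refine (norm_sub_le _ _).trans ?_
  refine (add_le_add_left (norm_sub_le _ _) _).trans (le_of_eq ?_)
  simp only [norm_mul, norm_div, norm_cexp_I_mul_ofReal_mul_ofReal] at hnorm ⊢
  rw [hnorm]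
  ring

lemma norm_integral_mul_cexp_le_of_norm_le {a b k : ℝ} (hab : a ≤ b) {v : ℝ → ℂ} {w : ℝ → ℝ}
    (hvw : ∀ x ∈ Ioc a b, ‖v x‖ ≤ w x) (hw : IntervalIntegrable w volume a b) :
    ‖∫ x in a..b, v x * Complex.exp (Complex.I * k * x)‖ ≤ ∫ x in a..b, w x := by
  refine intervalIntegral.norm_integral_le_of_norm_le hab (ae_of_all _ fun x hx => ?_) hw
  rw [norm_mul, norm_cexp_I_mul_ofReal_mul_ofReal, mul_one]
  exact hvw x hx

lemma norm_integral_mul_cexp_le_rpow {β b k N : ℝ} (hβ : 0 < β) (hb : 0 ≤ b) {v : ℝ → ℂ}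
    (hv : ∀ x ∈ Ioc 0 b, ‖v x‖ ≤ N * x ^ (β - 1)) :
    ‖∫ x in (0 : ℝ)..b, v x * Complex.exp (Complex.I * k * x)‖ ≤ N * b ^ β / β := by
  refine (norm_integral_mul_cexp_le_of_norm_le hb hv
    ((intervalIntegral.intervalIntegrable_rpow' (by linarith)).const_mul N)).trans (le_of_eq ?_)
  rw [intervalIntegral.integral_const_mul, integral_rpow (Or.inl (by linarith)),
    sub_add_cancel, Real.zero_rpow hβ.ne']
  ring

lemma intervalIntegrable_of_norm_le_rpow {β b N : ℝ} (hβ : 0 < β) (hb : 0 ≤ b) {v : ℝ → ℂ}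
    (hc : ContinuousOn v (Ioc 0 b)) (hv : ∀ x ∈ Ioc 0 b, ‖v x‖ ≤ N * x ^ (β - 1)) :
    IntervalIntegrable v volume 0 b := by
  have hw : IntervalIntegrable (fun x : ℝ => N * x ^ (β - 1)) volume 0 b :=
    (intervalIntegral.intervalIntegrable_rpow' (by linarith)).const_mul N
  rw [intervalIntegrable_iff_integrableOn_Ioc_of_le hb] at hw ⊢
  exact Integrable.mono' hw (hc.aestronglyMeasurable measurableSet_Ioc)
    ((ae_restrict_iff' measurableSet_Ioc).2 (ae_of_all _ hv))

/-- The part of an oscillatory integral beyond one wavelength, for an amplitude with an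
integrable algebraic singularity at `0`. -/
lemma norm_integral_inv_mul_cexp_le {β b k N : ℝ} (hβ : β < 1) (hk : 0 < k)
    (hb : k⁻¹ ≤ b) (hN : 0 ≤ N) {u v : ℝ → ℂ}
    (hu : ContinuousOn u (Ioc 0 b)) (hv : ContinuousOn v (Ioc 0 b))
    (huv : ∀ x ∈ Ioo 0 b, HasDerivAt u (v x) x)
    (hu' : ∀ x ∈ Ioc 0 b, ‖u x‖ ≤ N * x ^ (β - 1))
    (hv' : ∀ x ∈ Ioc 0 b, ‖v x‖ ≤ N * x ^ (β - 2)) :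
    ‖∫ x in k⁻¹..b, u x * Complex.exp (Complex.I * k * x)‖ ≤
      N * (2 + 1 / (1 - β)) * k⁻¹ ^ β := by
  have hδ : 0 < k⁻¹ := inv_pos.2 hk
  have hb0 : 0 < b := hδ.trans_le hb
  have hsub : Icc k⁻¹ b ⊆ Ioc 0 b := fun x hx => ⟨hδ.trans_le hx.1, hx.2⟩
  have h0 : (0 : ℝ) ∉ uIcc k⁻¹ b := by
    rw [uIcc_of_le hb]
    exact fun h => absurd h.1 (not_le.2 hδ)
  have hvI : IntervalIntegrable v volume k⁻¹ b :=
    ContinuousOn.intervalIntegrable (by rw [uIcc_of_le hb]; exact hv.mono hsub)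
  have hB : ‖∫ x in k⁻¹..b, v x * Complex.exp (Complex.I * k * x)‖ ≤
      N * (k⁻¹ ^ (β - 1) / (1 - β)) := by
    refine (norm_integral_mul_cexp_le_of_norm_le hb
      (fun x hx => hv' x (hsub (Ioc_subset_Icc_self hx)))
      ((intervalIntegral.intervalIntegrable_rpow (Or.inr h0)).const_mul N)).trans ?_
    rw [intervalIntegral.integral_const_mul,
      integral_rpow (Or.inr ⟨by linarith, h0⟩), show β - 2 + 1 = β - 1 by ring]
    refine mul_le_mul_of_nonneg_left ?_ hN
    rw [← neg_div_neg_eq, neg_sub, neg_sub]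
    have := Real.rpow_nonneg hb0.le (β - 1)
    exact div_le_div_of_nonneg_right (by linarith) (by linarith)
  have hub : ‖u b‖ ≤ N * k⁻¹ ^ (β - 1) :=
    (hu' b ⟨hb0, le_rfl⟩).trans (mul_le_mul_of_nonneg_left
      (Real.rpow_le_rpow_of_nonpos hδ hb (by linarith)) hN)
  have hua := hu' _ (hsub (left_mem_Icc.2 hb))
  have hpow : k⁻¹ ^ β = 1 / k * k⁻¹ ^ (β - 1) := by
    rw [Real.rpow_sub_one hδ.ne']
    field_simp
  refine (norm_integral_mul_cexp_le_of_hasDerivAt hb hk (hu.mono hsub)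
    (fun x hx => huv x ⟨hδ.trans hx.1, hx.2⟩) hvI).trans ?_
  calc _ ≤ 1 / k * (N * k⁻¹ ^ (β - 1) + N * k⁻¹ ^ (β - 1) + N * (k⁻¹ ^ (β - 1) / (1 - β))) := by
        gcongr
    _ = _ := by rw [hpow]; ring

/-- Decay of an oscillatory integral whose amplitude has an integrable algebraic singularity
at `0`. -/
lemma norm_integral_singular_mul_cexp_le {β b k N t : ℝ} (hβ : β ∈ Ioo (0 : ℝ) 1) (hk : 0 < k)
    (hb : 0 < b) (hN : 0 ≤ N) (ht : t ∈ Icc 0 β) {u v : ℝ → ℂ}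
    (hu : ContinuousOn u (Ioc 0 b)) (hv : ContinuousOn v (Ioc 0 b))
    (huv : ∀ x ∈ Ioo 0 b, HasDerivAt u (v x) x)
    (hu' : ∀ x ∈ Ioc 0 b, ‖u x‖ ≤ N * x ^ (β - 1))
    (hv' : ∀ x ∈ Ioc 0 b, ‖v x‖ ≤ N * x ^ (β - 2)) :
    ‖∫ x in (0 : ℝ)..b, u x * Complex.exp (Complex.I * k * x)‖ ≤
      (1 / β + 2 + 1 / (1 - β)) * b ^ (β - t) * k⁻¹ ^ t * N := by
  obtain ⟨hβ0, hβ1⟩ := hβ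
  obtain ⟨ht0, htβ⟩ := ht
  have hδ : 0 < k⁻¹ := inv_pos.2 hk
  have h1β : 0 < 1 / (1 - β) := one_div_pos.2 (by linarith)
  rcases le_total b k⁻¹ with hle | hle
  · have hpow : b ^ β ≤ b ^ (β - t) * k⁻¹ ^ t := by
      calc b ^ β = b ^ (β - t) * b ^ t := by rw [← Real.rpow_add hb, sub_add_cancel]
        _ ≤ _ := by gcongr
    calc _ ≤ N * b ^ β / β := norm_integral_mul_cexp_le_rpow hβ0 hb.le hu'
      _ = 1 / β * (b ^ β) * N := by ring
      _ ≤ (1 / β + 2 + 1 / (1 - β)) * (b ^ (β - t) * k⁻¹ ^ t) * N := by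
        gcongr
        linarith
      _ = _ := by ring
  · have hpow : k⁻¹ ^ β ≤ b ^ (β - t) * k⁻¹ ^ t := by
      calc k⁻¹ ^ β = k⁻¹ ^ (β - t) * k⁻¹ ^ t := by rw [← Real.rpow_add hδ, sub_add_cancel]
        _ ≤ _ := by
          gcongr
    have hcont : Continuous fun x : ℝ => Complex.exp (Complex.I * k * x) := by fun_prop
    have hI : IntervalIntegrable (fun x => u x * Complex.exp (Complex.I * k * x)) volume 0 b :=
      (intervalIntegrable_of_norm_le_rpow hβ0 hb.le hu hu').mul_continuousOn hcont.continuousOn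
    have hmem : k⁻¹ ∈ uIcc 0 b := by rw [uIcc_of_le hb.le]; exact ⟨hδ.le, hle⟩
    rw [← intervalIntegral.integral_add_adjacent_intervals
      (hI.mono_set (uIcc_subset_uIcc left_mem_uIcc hmem))
      (hI.mono_set (uIcc_subset_uIcc hmem right_mem_uIcc))]
    calc _ ≤ N * k⁻¹ ^ β / β + N * (2 + 1 / (1 - β)) * k⁻¹ ^ β :=
          (norm_add_le _ _).trans (add_le_add
            (norm_integral_mul_cexp_le_rpow hβ0 hδ.le fun x hx => hu' x ⟨hx.1, hx.2.trans hle⟩)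
            (norm_integral_inv_mul_cexp_le hβ1 hk hle hN hu hv huv hu' hv'))
      _ = (1 / β + 2 + 1 / (1 - β)) * (k⁻¹ ^ β) * N := by ring
      _ ≤ (1 / β + 2 + 1 / (1 - β)) * (b ^ (β - t) * k⁻¹ ^ t) * N := by gcongr
      _ = _ := by ring

lemma norm_iteratedDerivWithin_le_snormPos {m j : ℕ} {β : ℝ} {f : ℝ → ℂ}
    (hf : BddAbove (snormSetPos m β f)) (hj : 1 ≤ j) (hjm : j ≤ m) {x : ℝ}
    (hx : x ∈ Ioc (0 : ℝ) 1) :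
    ‖iteratedDerivWithin j f (Ioc (0 : ℝ) 1) x‖ ≤ snormPos m β f * x ^ (β - j) := by
  have h : x ^ ((j : ℝ) - β) * ‖iteratedDerivWithin j f (Ioc (0 : ℝ) 1) x‖ ≤ snormPos m β f :=
    le_csSup hf (Or.inr ⟨j, hj, hjm, x, hx, rfl⟩)
  rw [← neg_sub (j : ℝ) β, Real.rpow_neg hx.1.le, ← div_eq_mul_inv,
    le_div_iff₀ (Real.rpow_pos_of_pos hx.1 _)]
  linarith

lemma norm_le_snormPos {m : ℕ} {β : ℝ} {f : ℝ → ℂ}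
    (hf : BddAbove (snormSetPos m β f)) {x : ℝ} (hx : x ∈ Icc (0 : ℝ) 1) :
    ‖f x‖ ≤ snormPos m β f :=
  le_csSup hf (Or.inl ⟨x, hx, rfl⟩)

lemma ContDiffOn.hasDerivAt_iteratedDerivWithin_Ioc {n : WithTop ℕ∞} {j : ℕ} {f : ℝ → ℂ}
    (hf : ContDiffOn ℝ n f (Ioc (0 : ℝ) 1)) (hj : (j : WithTop ℕ∞) < n) {x : ℝ}
    (hx : x ∈ Ioo (0 : ℝ) 1) :
    HasDerivAt (iteratedDerivWithin j f (Ioc (0 : ℝ) 1))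
      (iteratedDerivWithin (j + 1) f (Ioc (0 : ℝ) 1) x) x := by
  rw [iteratedDerivWithin_succ]
  exact ((hf.differentiableOn_iteratedDerivWithin hj (uniqueDiffOn_Ioc 0 1)) x
    (Ioo_subset_Ioc_self hx)).hasDerivWithinAt.hasDerivAt (Ioc_mem_nhds_iff.2 hx)

/-- Let `β ∈ (0,1)`. There is `C_β > 0` such that for every
`f ∈ C²_β[0,1]`, `ε ∈ (0,1]`, `k > 0` and `s ∈ [1, 1+β]`,
`|∫_0^ε f(x) exp(ikx) dx| ≤ (2/k) sup_{[0,1]}|f| + C_β ε^{1+β−s} (1/k)^s ‖f‖_{2,β}`. -/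
theorem singular_integral_estimate_pos_higher (β : ℝ) (hβ : β ∈ Set.Ioo (0 : ℝ) 1) :
    ∃ C : ℝ, 0 < C ∧
      ∀ f : ℝ → ℂ,
        ContinuousOn f (Set.Icc (0 : ℝ) 1) →
        ContDiffOn ℝ 2 f (Set.Ioc (0 : ℝ) 1) →
        BddAbove (snormSetPos 2 β f) →
        ∀ ε ∈ Set.Ioc (0 : ℝ) 1, ∀ k : ℝ, 0 < k → ∀ s ∈ Set.Icc (1 : ℝ) (1 + β),
          ‖∫ x in (0 : ℝ)..ε, f x * Complex.exp (Complex.I * k * x)‖ ≤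
            (2 / k) * (⨆ x : Set.Icc (0 : ℝ) 1, ‖f (x : ℝ)‖) +
              C * ε ^ (1 + β - s) * (1 / k) ^ s * snormPos 2 β f := by
  have hβ0 := hβ.1
  have h1β : 0 < 1 - β := sub_pos.2 hβ.2
  refine ⟨1 / β + 2 + 1 / (1 - β), by positivity, fun f hfc hfd hfb ε hε k hk s hs => ?_⟩
  obtain ⟨hε0, hε1⟩ := hε
  have hN : 0 ≤ snormPos 2 β f :=
    (norm_nonneg _).trans (norm_le_snormPos hfb (left_mem_Icc.2 zero_le_one))
  have hsub : Ioc 0 ε ⊆ Ioc (0 : ℝ) 1 := Ioc_subset_Ioc_right hε1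
  have hsub' : Ioo 0 ε ⊆ Ioo (0 : ℝ) 1 := Ioo_subset_Ioo_right hε1
  have hcont (j : ℕ) (hj : j ≤ 2) :
      ContinuousOn (iteratedDerivWithin j f (Ioc (0 : ℝ) 1)) (Ioc 0 ε) :=
    (hfd.continuousOn_iteratedDerivWithin (by exact_mod_cast hj) (uniqueDiffOn_Ioc 0 1)).mono hsub
  have hbound1 (x : ℝ) (hx : x ∈ Ioc 0 ε) :=
    norm_iteratedDerivWithin_le_snormPos hfb le_rfl one_le_two (hsub hx)
  have hbound2 (x : ℝ) (hx : x ∈ Ioc 0 ε) :=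
    norm_iteratedDerivWithin_le_snormPos hfb one_le_two le_rfl (hsub hx)
  push_cast at hbound1 hbound2
  have hderiv (x : ℝ) (hx : x ∈ Ioo 0 ε) :
      HasDerivAt f (iteratedDerivWithin 1 f (Ioc (0 : ℝ) 1) x) x := by
    simpa using hfd.hasDerivAt_iteratedDerivWithin_Ioc (j := 0) (by norm_num) (hsub' hx)
  have hsup (x : ℝ) (hx : x ∈ Icc (0 : ℝ) 1) : ‖f x‖ ≤ ⨆ x : Icc (0 : ℝ) 1, ‖f (x : ℝ)‖ := by
    refine le_ciSup (f := fun x : Icc (0 : ℝ) 1 => ‖f (x : ℝ)‖) ⟨snormPos 2 β f, ?_⟩ ⟨x, hx⟩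
    rintro _ ⟨y, rfl⟩
    exact norm_le_snormPos hfb y.2
  have hmain := norm_integral_singular_mul_cexp_le (t := s - 1) hβ hk hε0 hN
    ⟨by linarith [hs.1], by linarith [hs.2]⟩ (hcont 1 one_le_two) (hcont 2 le_rfl)
    (fun x hx => hfd.hasDerivAt_iteratedDerivWithin_Ioc (by norm_num) (hsub' hx))
    hbound1 hbound2
  have hpow : (1 / k) ^ s = 1 / k * k⁻¹ ^ (s - 1) := by
    rw [Real.rpow_sub_one (inv_pos.2 hk).ne', one_div]
    field_simp
  rw [show β - (s - 1) = 1 + β - s by ring] at hmain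
  refine (norm_integral_mul_cexp_le_of_hasDerivAt hε0.le hk
    (hfc.mono (Icc_subset_Icc_right hε1)) hderiv
    (intervalIntegrable_of_norm_le_rpow hβ0 hε0.le (hcont 1 one_le_two) hbound1)).trans ?_
  refine (mul_le_mul_of_nonneg_left (add_le_add (add_le_add (hsup ε ⟨hε0.le, hε1⟩)
    (hsup 0 (left_mem_Icc.2 zero_le_one))) hmain) (one_div_pos.2 hk).le).trans (le_of_eq ?_)
  rw [hpow]
  ring
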